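/- Let L > 0 and let V : ℝ → ℝ be twice continuously differentiable with V(0) = V(L) and V(q) < V(0) for all q ∈ (0, L). Let I ⊂ ℝ be an interval containing 0 and let q, p : I → ℝ be C¹ functions satisfying q̇(t) = p(t), ṗ(t) = −V′(q(t)) for all t ∈ I, with q(0) = 0 and p(0) = 0. Then q(t) ∈ [0, L] for all t ∈ I. -/

import Mathlib

open Set Filter Topology

/-- A solution on an interval of an autonomous ODE with `C¹` right-hand side that passes through
an equilibrium is constant. -/
theorem eq_equilibrium_of_hasDerivWithinAt {E : Type*} [NormedAddCommGroup E] [NormedSpace ℝ E]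
    {v : E → E} (hv : ContDiff ℝ 1 v) {I : Set ℝ} (hI : I.OrdConnected) {γ : ℝ → E}
    (hγ : ∀ t ∈ I, HasDerivWithinAt γ (v (γ t)) I t) {a t : ℝ} (ha : a ∈ I) (ht : t ∈ I)
    (hva : v (γ a) = 0) : γ t = γ a := by
  have hlip : ∀ b c, Icc b c ⊆ I → ∃ K, LipschitzOnWith K v (γ '' Icc b c) := fun b c hbc ↦
    hv.locallyLipschitz.locallyLipschitzOn.exists_lipschitzOnWith_of_compact
      (isCompact_Icc.image_of_continuousOn
        fun s hs ↦ (hγ s (hbc hs)).continuousWithinAt.mono hbc)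
  rcases le_total a t with hat | hta
  · have hsub : Icc a t ⊆ I := hI.out ha ht
    obtain ⟨K, hK⟩ := hlip a t hsub
    refine ODE_solution_unique_of_mem_Icc_right (v := fun _ ↦ v) (s := fun _ ↦ γ '' Icc a t)
      (g := fun _ ↦ γ a) (fun _ _ ↦ hK)
      (fun s hs ↦ (hγ s (hsub hs)).continuousWithinAt.mono hsub) (fun s hs ↦ ?_)
      (fun s hs ↦ mem_image_of_mem γ (Ico_subset_Icc_self hs)) continuousOn_const
      (fun s _ ↦ ?_) (fun _ _ ↦ mem_image_of_mem γ (left_mem_Icc.2 hat)) rfl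
      (right_mem_Icc.2 hat)
    · exact (hγ s (hsub (Ico_subset_Icc_self hs))).mono_of_mem_nhdsWithin
        (mem_of_superset (Icc_mem_nhdsGE hs.2) ((Icc_subset_Icc_left hs.1).trans hsub))
    · simpa only [hva] using hasDerivWithinAt_const s (Ici s) (γ a)
  · have hsub : Icc t a ⊆ I := hI.out ht ha
    obtain ⟨K, hK⟩ := hlip t a hsub
    refine ODE_solution_unique_of_mem_Icc_left (v := fun _ ↦ v) (s := fun _ ↦ γ '' Icc t a)
      (g := fun _ ↦ γ a) (fun _ _ ↦ hK)
      (fun s hs ↦ (hγ s (hsub hs)).continuousWithinAt.mono hsub) (fun s hs ↦ ?_)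
      (fun s hs ↦ mem_image_of_mem γ (Ioc_subset_Icc_self hs)) continuousOn_const
      (fun s _ ↦ ?_) (fun _ _ ↦ mem_image_of_mem γ (right_mem_Icc.2 hta)) rfl
      (left_mem_Icc.2 hta)
    · exact (hγ s (hsub (Ioc_subset_Icc_self hs))).mono_of_mem_nhdsWithin
        (mem_of_superset (Icc_mem_nhdsLE hs.1) ((Icc_subset_Icc_right hs.2).trans hsub))
    · simpa only [hva] using hasDerivWithinAt_const s (Iic s) (γ a)

/-- Conservation of energy for `H(q, p) = p² / 2 + V(q)`. -/
theorem energy_eq_of_hamilton {V : ℝ → ℝ} (hV : Differentiable ℝ V) {I : Set ℝ}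
    (hI : I.OrdConnected) {q p : ℝ → ℝ} (hq : ∀ t ∈ I, HasDerivWithinAt q (p t) I t)
    (hp : ∀ t ∈ I, HasDerivWithinAt p (-(deriv V (q t))) I t) {a t : ℝ} (ha : a ∈ I)
    (ht : t ∈ I) : p t ^ 2 / 2 + V (q t) = p a ^ 2 / 2 + V (q a) := by
  have hH : ∀ s ∈ I, HasDerivWithinAt (fun s ↦ p s ^ 2 / 2 + V (q s)) 0 I s := fun s hs ↦ by
    have h := (((hp s hs).pow 2).div_const 2).add
      ((hV (q s)).hasDerivAt.comp_hasDerivWithinAt s (hq s hs))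
    refine h.congr_deriv ?_
    norm_num
    ring
  have h := hI.convex.norm_image_sub_le_of_norm_hasDerivWithin_le hH
    (fun _ _ ↦ norm_zero.le) ha ht
  rw [zero_mul, norm_le_zero_iff] at h
  exact sub_eq_zero.1 h

/-- A motion whose energy is `V c` does not cross `c` from the left if `V` is less than `V c`
immediately to the left of `c`. -/
theorem le_of_hamilton_of_eventually_lt {V : ℝ → ℝ} (hV : ContDiff ℝ 2 V) {I : Set ℝ}
    (hI : I.OrdConnected) {q p : ℝ → ℝ} (hq : ∀ t ∈ I, HasDerivWithinAt q (p t) I t)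
    (hp : ∀ t ∈ I, HasDerivWithinAt p (-(deriv V (q t))) I t) {a c : ℝ} (ha : a ∈ I)
    (hqa : q a ≤ c) (hE : p a ^ 2 / 2 + V (q a) = V c) (hVc : ∀ᶠ x in 𝓝[<] c, V x < V c)
    {t : ℝ} (ht : t ∈ I) : q t ≤ c := by
  by_contra! hqt
  have hdV : Differentiable ℝ V := hV.differentiable two_ne_zero
  have henergy : ∀ s ∈ I, p s ^ 2 / 2 + V (q s) = V c := fun s hs ↦
    (energy_eq_of_hamilton hdV hI hq hp ha hs).trans hE
  have hivt : ∀ y ∈ Icc c (q t), ∃ s ∈ I, q s = y := fun y hy ↦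
    hI.isPreconnected.intermediate_value ha ht
      (fun s hs ↦ (hq s hs).continuousWithinAt) ⟨hqa.trans hy.1, hy.2⟩
  have hslope := hasDerivAt_iff_tendsto_slope.1 (hdV c).hasDerivAt
  have hderiv : 0 ≤ deriv V c := by
    refine ge_of_tendsto (x := 𝓝[<] c)
      (hslope.mono_left (nhdsWithin_mono c fun x hx ↦ ne_of_lt hx)) ?_
    filter_upwards [hVc, self_mem_nhdsWithin] with x hx hxc
    rw [slope_def_field]
    exact div_nonneg_of_nonpos (by linarith) (sub_nonpos.2 (le_of_lt hxc))
  rcases hderiv.eq_or_lt with h | h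
  · obtain ⟨s, hs, hqs⟩ := hivt c ⟨le_rfl, hqt.le⟩
    have hps : p s = 0 := by
      have := henergy s hs
      rw [hqs] at this
      exact pow_eq_zero_iff two_ne_zero |>.1 (by linarith)
    have hdV1 : ContDiff ℝ 1 (deriv V) := hV.deriv'
    have := eq_equilibrium_of_hasDerivWithinAt (v := fun z : ℝ × ℝ ↦ (z.2, -deriv V z.1))
      (γ := fun u ↦ (q u, p u))
      (contDiff_snd.prodMk (hdV1.comp contDiff_fst).neg) hI
      (fun u hu ↦ (hq u hu).prodMk (hp u hu)) hs ht (by simp [hps, hqs, ← h])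
    have hqts : q t = q s := congrArg Prod.fst this
    exact hqt.ne' (hqts.trans hqs)
  · have hgt : ∀ᶠ x in 𝓝[>] c, 0 < slope V c x :=
      (hslope.mono_left (nhdsWithin_mono c fun x hx ↦ ne_of_gt hx)).eventually_const_lt h
    obtain ⟨y, hy, hyc⟩ := (hgt.and (Ioo_mem_nhdsGT hqt)).exists
    obtain ⟨s, hs, rfl⟩ := hivt y (Ioo_subset_Icc_self hyc)
    rw [slope_def_field, div_pos_iff_of_pos_right (sub_pos.2 hyc.1)] at hy
    linarith [henergy s hs, sq_nonneg (p s)]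


/-- **Confinement of bounded motion.**
Let `L > 0` and let `V : ℝ → ℝ` be twice continuously differentiable with
`V(0) = V(L)` and `V(q) < V(0)` for all `q ∈ (0, L)` (a bounded potential).  If
`I ∋ 0` is an interval and `q, p : I → ℝ` are C¹ functions satisfying Hamilton's
equations `q̇ = p`, `ṗ = −V′(q)` on `I` with `q(0) = 0` and `p(0) = 0`, then the
motion is confined: `q(t) ∈ [0, L]` for all `t ∈ I`. -/
theorem bounded_potential_confines_motion
    (L : ℝ) (hL : 0 < L)
    (V : ℝ → ℝ) (hV : ContDiff ℝ 2 V)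
    (hVL : V 0 = V L) (hVlt : ∀ x ∈ Set.Ioo 0 L, V x < V 0)
    (I : Set ℝ) (h0 : (0 : ℝ) ∈ I) (hI : I.OrdConnected)
    (q p : ℝ → ℝ)
    (hq : ∀ t ∈ I, HasDerivWithinAt q (p t) I t)
    (hp : ∀ t ∈ I, HasDerivWithinAt p (-(deriv V (q t))) I t)
    (hq0 : q 0 = 0) (hp0 : p 0 = 0) :
    ∀ t ∈ I, q t ∈ Set.Icc 0 L := by
  intro t ht
  constructor
  · have hW : ContDiff ℝ 2 fun x ↦ V (-x) := hV.comp contDiff_neg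
    have h := le_of_hamilton_of_eventually_lt (q := fun s ↦ -q s) (p := fun s ↦ -p s) (c := 0)
      hW hI (fun s hs ↦ (hq s hs).neg)
      (fun s hs ↦ (hp s hs).neg.congr_deriv (by simp [deriv_comp_neg])) h0 (by simp [hq0])
      (by simp [hq0, hp0]) ?_ ht
    · linarith
    · filter_upwards [Ioo_mem_nhdsLT (neg_lt_zero.2 hL)] with x hx
      simpa using hVlt (-x) ⟨by linarith [hx.2], by linarith [hx.1]⟩
  · refine le_of_hamilton_of_eventually_lt hV hI hq hp h0 (hq0.trans_le hL.le)
      (by simp [hq0, hp0, hVL]) ?_ ht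
    filter_upwards [Ioo_mem_nhdsLT hL] with x hx
    exact hVL ▸ hVlt x hx
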